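/- arXiv:1404.4269 — 4 statements merged into one kernel-verified Lean document; each statement's English description precedes it below -/
import Mathlib

section
/- Let ω be a factor of the Fibonacci word F_∞ with ω ∉ {ε, ab, ba, aba}. Then (1) ω has a unique singular kernel sk(ω), i.e., among all singular words occurring in ω there is a unique longest one, and this word occurs in ω exactly once; (2) consequently ω admits a unique decomposition ω = μ₁ · sk(ω) · μ₂ for words μ₁, μ₂ over {a,b}. -/
/-- Finite Fibonacci words: `Fw k = σ^k(a)` where `a = false`, `b = true`,
`σ(a) = ab`, `σ(b) = a`; so `Fw (k+2) = Fw (k+1) ++ Fw k`. -/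
def Fw : ℕ → List Bool
  | 0 => [false]
  | 1 => [false, true]
  | (k+2) => Fw (k+1) ++ Fw k

/-- The infinite Fibonacci word `F_∞` (0-indexed): since `Fw (n+1)` has length
`fib (n+3) > n`, its `n`-th letter is the `n`-th letter of `F_∞`. -/
def fw (n : ℕ) : Bool := (Fw (n+1)).getD n false

/-- Singular words, with index shifted by one: `sw n = s_{n-1}`.
`sw 0 = s_{-1} = a`, and `sw (n+1) = s_n = β_n · F_n · α_n⁻¹` where
`α_n` is the last letter of `F_n` and `β_n` the other letter. -/
def sw : ℕ → List Bool
  | 0 => [false]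
  | (n+1) => (!((Fw n).getLastD false)) :: (Fw n).dropLast

/-- The factor of `F_∞` of length `n` starting at (0-indexed) position `i`. -/
def seg (i n : ℕ) : List Bool := (List.range n).map (fun t => fw (i + t))

/-- `w` occurs in `F_∞` at (0-indexed) position `i`. -/
def OccursAt (w : List Bool) (i : ℕ) : Prop := seg i w.length = w

/-- `w` is a factor of `F_∞`. -/
def IsFactor (w : List Bool) : Prop := ∃ i, OccursAt w i

/-- Starting position of the `(p+1)`-st occurrence of `w` in `F_∞`
(occurrences enumerated by starting position, 0-indexed: `occPos w 0`
is the first occurrence, i.e. the paper's `ω_1`). -/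
noncomputable def occPos (w : List Bool) (p : ℕ) : ℕ := Nat.nth (OccursAt w) p

/-- A finite word viewed as an element of the free group on the alphabet. -/
def listToFree (w : List Bool) : FreeGroup Bool := (w.map FreeGroup.of).prod

/-- The gap `ν_{w,p}` (0-indexed in `p`: `gap w 0` is the paper's `ν_{w,1}`)
between the `(p+1)`-st and `(p+2)`-nd occurrences of `w`, as an element of the
free group: the separating word if the occurrences are separated or adjacent,
and the formal inverse of the overlap if they overlap. -/
noncomputable def gap (w : List Bool) (p : ℕ) : FreeGroup Bool :=
  if occPos w p + w.length ≤ occPos w (p+1) then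
    listToFree (seg (occPos w p + w.length) (occPos w (p+1) - (occPos w p + w.length)))
  else
    (listToFree (seg (occPos w (p+1)) (occPos w p + w.length - occPos w (p+1))))⁻¹

/-- The signed length `|ν_{w,p}|` of the gap (negative in the overlapped case). -/
noncomputable def gapLen (w : List Bool) (p : ℕ) : ℤ :=
  (occPos w (p+1) : ℤ) - ((occPos w p : ℤ) + (w.length : ℤ))

/-- `u` is a singular word (some `s_k`, `k ≥ -1`). -/
def IsSingular (u : List Bool) : Prop := ∃ n, u = sw n

/-- `u` is a singular kernel of `w`: a singular factor of `w` of maximal length. -/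
def IsKernelOf (u w : List Bool) : Prop :=
  IsSingular u ∧ u <:+: w ∧ ∀ v : List Bool, IsSingular v → v <:+: w → v.length ≤ u.length

/-- The excluded words `{ε, ab, ba, aba}`. -/
def excl : List (List Bool) := [[], [false, true], [true, false], [false, true, false]]

/-- The `i`-th conjugate `C_i(w)` (indices taken mod the length). -/
def conj (i : ℕ) (w : List Bool) : List Bool :=
  w.drop (i % w.length) ++ w.take (i % w.length)

/-- `sliceW u i j = u[i,j]`, the letters `i` through `j` of `u`, 1-indexed. -/
def sliceW (u : List Bool) (i j : ℕ) : List Bool := (u.take j).drop (i - 1)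

/-- The Fibonacci morphism `a ↦ ab`, `b ↦ a`. -/
def fibMorph (w : List Bool) : List Bool :=
  w.flatMap fun c => if c then [false] else [false, true]

/-- The Fibonacci morphism followed by an extra letter `a`; occurrences of words of this form
are synchronized with the blocks of the morphism. -/
def fibExt (w : List Bool) : List Bool := fibMorph w ++ [false]

@[simp] theorem fibMorph_nil : fibMorph [] = [] := rfl

@[simp] theorem fibMorph_cons_false (w : List Bool) :
    fibMorph (false :: w) = false :: true :: fibMorph w := rfl

@[simp] theorem fibMorph_cons_true (w : List Bool) :
    fibMorph (true :: w) = false :: fibMorph w := rfl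

@[simp] theorem fibMorph_append (v w : List Bool) :
    fibMorph (v ++ w) = fibMorph v ++ fibMorph w := List.flatMap_append

@[simp] theorem fibExt_nil : fibExt [] = [false] := rfl

@[simp] theorem fibExt_cons_false (w : List Bool) :
    fibExt (false :: w) = false :: true :: fibExt w := rfl

@[simp] theorem fibExt_cons_true (w : List Bool) :
    fibExt (true :: w) = false :: fibExt w := rfl

theorem fibExt_append (v w : List Bool) : fibExt (v ++ w) = fibMorph v ++ fibExt w := by
  simp [fibExt]

theorem fibExt_eq_cons (w : List Bool) : ∃ t, fibExt w = false :: t := by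
  rcases w with _ | ⟨_ | _, w⟩ <;> simp

theorem fibExt_isInfix {v w : List Bool} (h : v <:+: w) : fibExt v <:+: fibExt w := by
  obtain ⟨p, q, rfl⟩ := h
  obtain ⟨t, ht⟩ := fibExt_eq_cons q
  exact ⟨fibMorph p, t, by
    rw [fibExt_append, ht]
    simp [fibExt]⟩

theorem isPrefix_of_fibExt {s v Q : List Bool} (h : fibExt s ++ Q = fibExt v) :
    s <+: v := by
  induction s generalizing v with
  | nil => exact ⟨v, rfl⟩
  | cons c s ih =>
    obtain ⟨t, ht⟩ := fibExt_eq_cons s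
    rcases v with _ | ⟨d, v⟩
    · cases c <;> simp [ht] at h
    · obtain ⟨r, hr⟩ := fibExt_eq_cons v
      cases c <;> cases d
      · simp at h
        simpa using ih h
      · simp [hr] at h
      · simp [ht] at h
      · simp at h
        simpa using ih h

theorem fibExt_sync {P s Q v : List Bool} (h : P ++ fibExt s ++ Q = fibExt v) :
    ∃ p q, v = p ++ s ++ q ∧ P = fibMorph p := by
  induction v generalizing P with
  | nil =>
    obtain ⟨t, ht⟩ := fibExt_eq_cons s
    rcases P with _ | ⟨x, P⟩
    · obtain ⟨q, hq⟩ := isPrefix_of_fibExt (v := []) (by simpa using h)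
      exact ⟨[], q, by simpa using hq.symm, rfl⟩
    · simp [ht] at h
  | cons d v ih =>
    obtain ⟨t, ht⟩ := fibExt_eq_cons s
    rcases P with _ | ⟨x, P⟩
    · obtain ⟨q, hq⟩ := isPrefix_of_fibExt (v := d :: v) (by simpa using h)
      exact ⟨[], q, by simpa using hq.symm, rfl⟩
    · cases d
      · rcases P with _ | ⟨y, P⟩
        · simp [ht] at h
        · simp only [List.cons_append, fibExt_cons_false, List.cons.injEq] at h
          obtain ⟨p, q, rfl, rfl⟩ := ih h.2.2
          exact ⟨false :: p, q, by simp, by simp [h.1, h.2.1]⟩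
      · simp only [List.cons_append, fibExt_cons_true, List.cons.injEq] at h
        obtain ⟨p, q, rfl, rfl⟩ := ih h.2
        exact ⟨true :: p, q, by simp, by simp [h.1]⟩

theorem exists_eq_fibExt_of_isInfix {u s v : List Bool} (hu : u <:+: fibExt v)
    (hp : fibExt s <+: u) (hs : fibExt s <:+ u) :
    ∃ z, z <:+: v ∧ u = fibExt z ∧ s <+: z ∧ s <:+ z := by
  obtain ⟨P, Q, h⟩ := hu
  obtain ⟨X, rfl⟩ := hp
  obtain ⟨Y, hY⟩ := hs
  obtain ⟨p, q, rfl, rfl⟩ := fibExt_sync (P := P) (s := s) (Q := X ++ Q) (v := v)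
    (by simpa using h)
  have h' : Y ++ fibExt s ++ Q = fibExt (s ++ q) := by
    rw [hY]
    simpa [fibExt_append] using h
  obtain ⟨p', q', he, rfl⟩ := fibExt_sync h'
  have hz : fibExt s ++ X = fibExt (p' ++ s) := by rw [fibExt_append, hY]
  exact ⟨p' ++ s, ⟨p, q', by simp [he]⟩, hz, isPrefix_of_fibExt hz,
    List.suffix_append _ _⟩

/-- In `fibExt v` every `b` is surrounded by `a`s. -/
theorem surrounded_of_fibExt {P Q v : List Bool} (h : P ++ true :: Q = fibExt v) :
    (∃ P', P = P' ++ [false]) ∧ ∃ Q', Q = false :: Q' := by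
  induction v generalizing P with
  | nil => rcases P with _ | ⟨x, _ | ⟨y, P⟩⟩ <;> simp at h
  | cons d v ih =>
    obtain ⟨t, ht⟩ := fibExt_eq_cons v
    cases d
    · rcases P with _ | ⟨x, _ | ⟨y, P⟩⟩
      · simp at h
      · simp at h
        exact ⟨⟨[], by simp [h.1]⟩, t, by rw [h.2, ht]⟩
      · simp only [List.cons_append, fibExt_cons_false, List.cons.injEq] at h
        obtain ⟨⟨P', rfl⟩, hQ⟩ := ih h.2.2
        exact ⟨⟨x :: y :: P', by simp⟩, hQ⟩
    · rcases P with _ | ⟨x, P⟩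
      · simp at h
      · simp only [List.cons_append, fibExt_cons_true, List.cons.injEq] at h
        obtain ⟨⟨P', rfl⟩, hQ⟩ := ih h.2
        exact ⟨⟨x :: P', by simp⟩, hQ⟩

theorem Fw_succ (n : ℕ) : Fw (n + 1) = fibMorph (Fw n) := by
  induction n using Nat.strong_induction_on with
  | _ n ih =>
    match n with
    | 0 => rfl
    | 1 => rfl
    | n + 2 =>
      have h : Fw (n + 2) = Fw (n + 1) ++ Fw n := rfl
      rw [Fw, h, fibMorph_append, ← ih (n + 1) (by omega), ← ih n (by omega), h]

theorem Fw_prefix_succ (n : ℕ) : Fw n <+: Fw (n + 1) := by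
  cases n with
  | zero => exact ⟨[true], rfl⟩
  | succ n => exact List.prefix_append _ _

theorem Fw_isPrefix {m n : ℕ} (h : m ≤ n) : Fw m <+: Fw n := by
  induction n, h using Nat.le_induction with
  | base => exact List.prefix_rfl
  | succ n _ ih => exact ih.trans (Fw_prefix_succ n)

theorem Fw_length_pos (n : ℕ) : 0 < (Fw n).length := by
  induction n using Nat.strong_induction_on with
  | _ n ih =>
    match n with
    | 0 => simp [Fw]
    | 1 => simp [Fw]
    | n + 2 => simpa [Fw] using Or.inl (ih (n + 1) (by omega))

theorem Fw_length_strictMono : StrictMono fun n => (Fw n).length := by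
  refine strictMono_nat_of_lt_succ fun n => ?_
  cases n with
  | zero => simp [Fw]
  | succ n => simpa [Fw] using Fw_length_pos n

theorem lt_Fw_length (n : ℕ) : n < (Fw n).length := by
  induction n with
  | zero => simp [Fw]
  | succ n ih => exact lt_of_le_of_lt ih (Fw_length_strictMono n.lt_succ_self)

theorem fw_eq_getElem {i N : ℕ} (h : i < N) :
    fw i = (Fw N)[i]'(h.trans (lt_Fw_length N)) := by
  have hi : i < (Fw (i + 1)).length := i.lt_succ_self.trans (lt_Fw_length _)
  rw [fw, List.getD_eq_getElem _ _ hi]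
  exact (Fw_isPrefix h).getElem hi

/-- `w` is a factor of some finite Fibonacci word. -/
def IsFibFactor (w : List Bool) : Prop := ∃ n, w <:+: Fw n

theorem IsFactor.isFibFactor {w : List Bool} (h : IsFactor w) : IsFibFactor w := by
  obtain ⟨i, hi⟩ := h
  refine ⟨i + w.length, ?_⟩
  have hlen := lt_Fw_length (i + w.length)
  have : w = ((Fw (i + w.length)).drop i).take w.length := by
    apply List.ext_getElem
    · simp; omega
    · intro t h1 h2
      have h3 : w[t] = fw (i + t) := by
        have := List.getElem_of_eq hi.symm h1
        simpa [seg] using this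
      rw [h3, fw_eq_getElem (N := i + w.length) (by omega)]
      simp
  refine ⟨(Fw (i + w.length)).take i, ((Fw (i + w.length)).drop i).drop w.length, ?_⟩
  conv_lhs => rw [List.append_assoc]; enter [2, 1]; rw [this]
  rw [List.take_append_drop, List.take_append_drop]

theorem IsFibFactor.mono {v w : List Bool} (hw : IsFibFactor w) (h : v <:+: w) :
    IsFibFactor v :=
  hw.imp fun _ hn => h.trans hn

theorem IsFibFactor.exists_fibExt {w : List Bool} (h : IsFibFactor w) :
    ∃ v, IsFibFactor v ∧ w <:+: fibExt v := by
  obtain ⟨n, hn⟩ := h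
  refine ⟨Fw n, ⟨n, List.infix_rfl⟩, hn.trans ?_⟩
  have h : Fw n <+: fibMorph (Fw n) := Fw_succ n ▸ Fw_prefix_succ n
  exact (h.trans (List.prefix_append _ [false])).isInfix

theorem IsFibFactor.surrounded {P Q : List Bool} (h : IsFibFactor (P ++ true :: Q)) :
    (P = [] ∨ ∃ P', P = P' ++ [false]) ∧ (Q = [] ∨ ∃ Q', Q = false :: Q') := by
  obtain ⟨v, -, A, B, hAB⟩ := h.exists_fibExt
  obtain ⟨⟨P', hP⟩, Q', hQ⟩ := surrounded_of_fibExt (P := A ++ P) (Q := Q ++ B) (v := v)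
    (by simpa using hAB)
  constructor
  · rcases P.eq_nil_or_concat with rfl | ⟨R, c, rfl⟩
    · exact Or.inl rfl
    · have := congrArg List.getLast? hP
      simp at this
      exact Or.inr ⟨R, by simp [this]⟩
  · rcases Q with _ | ⟨c, R⟩
    · exact Or.inl rfl
    · simp at hQ
      exact Or.inr ⟨R, by simp [hQ.1]⟩

/-- Parity-dependent shape of the singular words. -/
theorem sw_shape (n : ℕ) :
    (∃ D, sw (2 * n + 1) = true :: D ∧
      sw (2 * n + 2) = false :: (fibMorph D ++ [false])) ∧
    (∃ D, sw (2 * n + 2) = false :: D ∧ sw (2 * n + 3) = true :: fibMorph D) := by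
  have key : ∀ m D c, Fw m = D ++ [c] → sw (m + 1) = (!c) :: D := by
    intro m D c h
    simp [sw, h]
  have even : ∀ m D, Fw m = D ++ [false] → Fw (m + 1) = fibMorph D ++ [false, true] ∧
      Fw (m + 2) = fibMorph (fibMorph D ++ [false]) ++ [false] := by
    intro m D h
    have h1 : Fw (m + 1) = fibMorph D ++ [false, true] := by simp [Fw_succ m, h]
    exact ⟨h1, by simp [Fw_succ (m + 1), h1]⟩
  have hD : ∃ D, Fw (2 * n) = D ++ [false] := by
    induction n with
    | zero => exact ⟨[], rfl⟩
    | succ n ih => exact ih.elim fun D h => ⟨_, (even _ D h).2⟩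
  obtain ⟨D, h0⟩ := hD
  obtain ⟨h1, h2⟩ := even _ D h0
  have s2 := key (2 * n + 1) (fibMorph D ++ [false]) true (by simp [h1])
  exact ⟨⟨D, key _ D _ h0, s2⟩, _, s2, key (2 * n + 2) _ _ h2⟩

theorem sw_even_eq (n : ℕ) : sw (2 * n + 2) = fibExt (sw (2 * n + 1)) := by
  obtain ⟨⟨D, h1, h2⟩, -⟩ := sw_shape n
  rw [h1, h2]
  simp [fibExt]

theorem fibExt_sw_even (n : ℕ) :
    fibExt (sw (2 * n + 2)) = false :: (sw (2 * n + 3) ++ [false]) := by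
  obtain ⟨-, D, h1, h2⟩ := sw_shape n
  rw [h1, h2]
  simp [fibExt]

theorem sw_odd_head (n : ℕ) : ∃ D, sw (2 * n + 1) = true :: D := by
  obtain ⟨⟨D, h, -⟩, -⟩ := sw_shape n
  exact ⟨D, h⟩

theorem sw_odd_last (n : ℕ) : ∃ D, sw (2 * n + 1) = D ++ [true] := by
  cases n with
  | zero => exact ⟨[], rfl⟩
  | succ n =>
    have h := fibExt_sw_even n
    rw [sw_even_eq n, fibExt, fibExt, fibMorph_append] at h
    have h' : false :: sw (2 * n + 3) =
        fibMorph (fibMorph (sw (2 * n + 1))) ++ [false] ++ [true] := by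
      apply List.append_cancel_right (bs := [false])
      simpa using h.symm
    obtain ⟨D, hD⟩ := sw_odd_head (n + 1)
    rw [show 2 * (n + 1) + 1 = 2 * n + 3 by ring] at hD ⊢
    rcases hs : fibMorph (fibMorph (sw (2 * n + 1))) with _ | ⟨c, R⟩
    · simp [hs] at h'
      exact ⟨[], by simp [h']⟩
    · simp [hs] at h'
      exact ⟨R ++ [false], by simp [h'.2]⟩

theorem sw_even_head (n : ℕ) : ∃ D, sw (2 * n + 2) = false :: false :: D := by
  obtain ⟨D, h⟩ := sw_odd_head n
  obtain ⟨t, ht⟩ := fibExt_eq_cons D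
  exact ⟨t, by simp [sw_even_eq, h, ht]⟩

theorem sw_even_last (n : ℕ) : ∃ D, sw (2 * n + 2) = D ++ [false, false] := by
  obtain ⟨D, h⟩ := sw_odd_last n
  exact ⟨fibMorph D, by simp [sw_even_eq, h, fibExt]⟩

/-- A word occurring in `aua` strictly inside it occurs in `u`. -/
theorem isInfix_of_cons_concat {α : Type*} {c d : α} {u w P Q : List α}
    (h : P ++ w ++ Q = c :: (u ++ [d])) (hP : P ≠ []) (hQ : Q ≠ []) : w <:+: u := by
  obtain ⟨x, P, rfl⟩ := List.exists_cons_of_ne_nil hP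
  obtain ⟨Q, y, rfl⟩ := (List.eq_nil_or_concat Q).resolve_left hQ
  refine ⟨P, Q, ?_⟩
  simp only [List.cons_append, List.cons.injEq] at h
  have h2 := h.2
  rw [List.concat_eq_append, ← List.append_assoc] at h2
  exact (List.append_inj' h2 rfl).1

theorem sw_succ_isInfix {m : ℕ} (hm : 1 ≤ m) {u C D : List Bool}
    (hC : u = true :: C) (hD : u = D ++ [true])
    (h : fibExt (sw m) <:+: false :: (u ++ [false])) : sw (m + 1) <:+: u := by
  obtain ⟨k, rfl | rfl⟩ : ∃ k, m = 2 * k + 1 ∨ m = 2 * k + 2 := ⟨(m - 1) / 2, by omega⟩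
  · rw [← sw_even_eq] at h
    obtain ⟨P, Q, h⟩ := h
    refine isInfix_of_cons_concat h ?_ ?_
    · rintro rfl
      obtain ⟨R, hR⟩ := sw_even_head k
      simp [hR, hC] at h
    · rintro rfl
      obtain ⟨R, hR⟩ := sw_even_last k
      rw [hR, hD] at h
      have := congrArg List.reverse h
      simp at this
  · rw [fibExt_sw_even] at h
    obtain ⟨P, Q, h⟩ := h
    exact isInfix_of_cons_concat (P := P ++ [false]) (Q := false :: Q)
      (by simpa using h) (by simp) (by simp)

/-- A factor with two distinct occurrences of a singular word, one at each end, contains a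
later singular word. -/
theorem exists_later_sw_isInfix (n : ℕ) {u : List Bool} (hu : IsFibFactor u)
    (hp : sw (n + 1) <+: u) (hs : sw (n + 1) <:+ u) (hne : sw (n + 1) ≠ u) :
    ∃ m, n + 1 < m ∧ sw m <:+: u := by
  induction n generalizing u with
  | zero =>
    obtain ⟨x, rfl⟩ := hp
    have hb : sw (0 + 1) = [true] := rfl
    rw [hb] at hu hs hne ⊢
    obtain ⟨-, rfl | ⟨x, rfl⟩⟩ := IsFibFactor.surrounded (P := []) hu
    · simp at hne
    · rcases x with _ | ⟨_ | _, x⟩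
      · obtain ⟨t, ht⟩ := hs
        have := congrArg List.getLast? ht
        simp at this
      · exact ⟨2, by omega, [true], x, rfl⟩
      · exact ⟨3, by omega, [], x, rfl⟩
  | succ n ih =>
    obtain ⟨v, hv, huv⟩ := hu.exists_fibExt
    obtain ⟨k, rfl | rfl⟩ : ∃ k, n = 2 * k ∨ n = 2 * k + 1 := ⟨n / 2, by omega⟩
    · rw [sw_even_eq] at hp hs hne
      obtain ⟨z, hz, rfl, hzp, hzs⟩ := exists_eq_fibExt_of_isInfix huv hp hs
      obtain ⟨m, hm, hmz⟩ := ih (hv.mono hz) hzp hzs fun h => hne (by rw [h])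
      have hmu := fibExt_isInfix hmz
      refine ⟨m + 1, by omega, ?_⟩
      obtain ⟨j, rfl | rfl⟩ : ∃ j, m = 2 * j + 1 ∨ m = 2 * j + 2 := ⟨(m - 1) / 2, by omega⟩
      · rwa [sw_even_eq]
      · rw [fibExt_sw_even] at hmu
        exact List.IsInfix.trans ⟨[false], [false], rfl⟩ hmu
    · rw [show 2 * k + 1 + 1 + 1 = 2 * k + 3 by ring] at hp hs hne
      obtain ⟨C, hC⟩ : ∃ C, sw (2 * k + 3) = true :: C := sw_odd_head (k + 1)
      obtain ⟨D, hD⟩ : ∃ D, sw (2 * k + 3) = D ++ [true] := sw_odd_last (k + 1)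
      obtain ⟨X, hX⟩ := hp
      obtain ⟨Y, hY⟩ := hs
      have hX0 : X ≠ [] := by rintro rfl; simp at hX; exact hne hX
      have hY0 : Y ≠ [] := by rintro rfl; simp at hY; exact hne hY
      obtain ⟨X, rfl⟩ : ∃ X', X = false :: X' := by
        refine (IsFibFactor.surrounded (P := D) (Q := X) ?_).2.resolve_left hX0
        rw [← hX, hD] at hu
        simpa using hu
      obtain ⟨Y, rfl⟩ : ∃ Y', Y = Y' ++ [false] := by
        refine (IsFibFactor.surrounded (P := Y) (Q := C) ?_).1.resolve_left hY0
        rw [← hY, hC] at hu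
        simpa using hu
      have huC : u = true :: (C ++ false :: X) := by rw [← hX, hC]; simp
      have huD : u = Y ++ [false] ++ D ++ [true] := by rw [← hY, hD]; simp
      obtain ⟨P, Q, hPQ⟩ := huv
      obtain ⟨P, rfl⟩ : ∃ P', P = P' ++ [false] :=
        (surrounded_of_fibExt (P := P) (Q := C ++ false :: X ++ Q) (v := v)
          (by rw [← hPQ, huC]; simp)).1
      obtain ⟨Q, rfl⟩ : ∃ Q', Q = false :: Q' :=
        (surrounded_of_fibExt (P := P ++ [false] ++ (Y ++ [false] ++ D)) (v := v)
          (by rw [← hPQ, huD]; simp)).2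
      obtain ⟨z, hz, hzu, hzp, hzs⟩ :=
        exists_eq_fibExt_of_isInfix (u := false :: (u ++ [false])) (s := sw (2 * k + 2)) (v := v)
          ⟨P, Q, by rw [← hPQ]; simp⟩
          ⟨X ++ [false], by rw [fibExt_sw_even, ← hX]; simp⟩
          ⟨false :: Y, by rw [fibExt_sw_even, ← hY]; simp⟩
      obtain ⟨m, hm, hmz⟩ := ih (hv.mono hz) hzp hzs (by
        rintro rfl
        rw [fibExt_sw_even] at hzu
        simp at hzu
        exact hne hzu.symm)
      exact ⟨m + 1, by omega,
        sw_succ_isInfix (by omega) huC huD (hzu ▸ fibExt_isInfix hmz)⟩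

theorem sw_succ_length (n : ℕ) : (sw (n + 1)).length = (Fw n).length := by
  have := Fw_length_pos n
  simp [sw]
  omega

theorem sw_length_lt {m n : ℕ} (hm : 1 ≤ m) (h : m < n) : (sw m).length < (sw n).length := by
  obtain ⟨m, rfl⟩ := Nat.exists_eq_add_of_le' hm
  obtain ⟨n, rfl⟩ := Nat.exists_eq_add_of_le' (hm.trans h.le)
  rw [sw_succ_length, sw_succ_length]
  exact Fw_length_strictMono (by omega)

theorem sw_ne_nil (n : ℕ) : sw n ≠ [] := by
  cases n <;> simp [sw]

/-- A factor outside the excluded list is a letter or contains a singular word of length at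
least two. -/
theorem IsFibFactor.letter_or_sw_isInfix {w : List Bool} (h : IsFibFactor w) (hne : w ∉ excl) :
    (∃ c, w = [c]) ∨ ∃ m, 2 ≤ m ∧ sw m <:+: w := by
  have hbb : ¬ [true, true] <:+: w := by
    rintro ⟨P, Q, rfl⟩
    have := (IsFibFactor.surrounded (P := P) (Q := true :: Q) (by simpa using h)).2
    simp at this
  by_contra! hcon
  obtain ⟨hlet, hsw⟩ := hcon
  have haa : ¬ [false, false] <:+: w := hsw 2 le_rfl
  have hbab : ¬ [true, false, true] <:+: w := hsw 3 (by omega)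
  simp only [excl, List.mem_cons, List.not_mem_nil, or_false, not_or] at hne
  rcases w with _ | ⟨x, _ | ⟨y, _ | ⟨z, _ | ⟨t, w⟩⟩⟩⟩
  · simp at hne
  · exact hlet x rfl
  · revert hne hbb haa; cases x <;> cases y <;> simp
  · revert hne hbb haa hbab
    cases x <;> cases y <;> cases z <;> simp [List.infix_cons_iff]
  · revert hbb haa hbab
    cases x <;> cases y <;> cases z <;> cases t <;> simp [List.infix_cons_iff]

theorem exists_isKernelOf {w : List Bool} (hl : (∃ c, w = [c]) ∨
    ∃ m, 2 ≤ m ∧ sw m <:+: w) : ∃ u, IsKernelOf u w := by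
  have hex : ∃ l u, u.length = l ∧ IsSingular u ∧ u <:+: w := by
    rcases hl with ⟨c, rfl⟩ | ⟨m, -, hm⟩
    · cases c
      · exact ⟨1, [false], rfl, ⟨0, rfl⟩, List.infix_rfl⟩
      · exact ⟨1, [true], rfl, ⟨1, rfl⟩, List.infix_rfl⟩
    · exact ⟨_, sw m, rfl, ⟨m, rfl⟩, hm⟩
  classical
  obtain ⟨l, u, hu⟩ := hex
  have hle : l ≤ w.length := hu.1 ▸ hu.2.2.length_le
  obtain ⟨v, hv, hsing, hvw⟩ := Nat.findGreatest_spec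
    (P := fun l => ∃ u : List Bool, u.length = l ∧ IsSingular u ∧ u <:+: w) hle ⟨u, hu⟩
  refine ⟨v, hsing, hvw, fun v' hs' hw' => ?_⟩
  rw [hv]
  exact Nat.le_findGreatest hw'.length_le ⟨v', rfl, hs', hw'⟩

theorem eq_singleton_of_isInfix {α : Type*} {u : List α} {c : α} (h : u <:+: [c]) (hu : u ≠ []) :
    u = [c] :=
  h.eq_of_length_le (List.length_pos_iff.2 hu)

theorem IsKernelOf.ne_nil {u w : List Bool} (h : IsKernelOf u w) : u ≠ [] := by
  obtain ⟨⟨n, rfl⟩, -⟩ := h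
  exact sw_ne_nil n

theorem IsKernelOf.exists_sw {u w : List Bool} (h : IsKernelOf u w)
    (hw : ∃ m, 2 ≤ m ∧ sw m <:+: w) : ∃ n, u = sw (n + 1) := by
  obtain ⟨⟨n, rfl⟩, -, hmax⟩ := h
  obtain ⟨m, hm, hmw⟩ := hw
  cases n with
  | zero =>
    have h1 := hmax _ ⟨m, rfl⟩ hmw
    have h2 : (sw 1).length < (sw m).length := sw_length_lt le_rfl hm
    simp [sw] at h1 h2
    omega
  | succ n => exact ⟨n, rfl⟩

theorem IsKernelOf.unique {u v w : List Bool} (hu : IsKernelOf u w) (hv : IsKernelOf v w)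
    (hl : (∃ c, w = [c]) ∨ ∃ m, 2 ≤ m ∧ sw m <:+: w) : u = v := by
  rcases hl with ⟨c, rfl⟩ | hl
  · rw [eq_singleton_of_isInfix hu.2.1 hu.ne_nil, eq_singleton_of_isInfix hv.2.1 hv.ne_nil]
  · have h1 := hu.2.2 v hv.1 hv.2.1
    have h2 := hv.2.2 u hu.1 hu.2.1
    obtain ⟨m, rfl⟩ := hu.exists_sw hl
    obtain ⟨n, rfl⟩ := hv.exists_sw hl
    rcases lt_trichotomy (m + 1) (n + 1) with h | h | h
    · exact absurd (sw_length_lt (by omega) h) (by omega)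
    · rw [h]
    · exact absurd (sw_length_lt (by omega) h) (by omega)

theorem IsKernelOf.length_le_of_decomp {u w p q p' q' : List Bool} (hw : IsFibFactor w)
    (hu : IsKernelOf u w) (hl : (∃ c, w = [c]) ∨ ∃ m, 2 ≤ m ∧ sw m <:+: w)
    (h : w = p ++ u ++ q) (h' : w = p' ++ u ++ q') : p'.length ≤ p.length := by
  rcases hl with ⟨c, rfl⟩ | hl
  · have h1 := congrArg List.length h'
    have := List.length_pos_iff.2 hu.ne_nil
    simp at h1
    omega
  · by_contra! hlt
    obtain ⟨n, rfl⟩ := hu.exists_sw hl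
    obtain ⟨r, rfl⟩ : p <+: p' := by
      refine List.prefix_of_prefix_length_le (l₃ := w) ⟨sw (n + 1) ++ q, ?_⟩
        ⟨sw (n + 1) ++ q', ?_⟩ hlt.le
      · simp [h]
      · simp [h']
    have hr : r ≠ [] := by rintro rfl; simp at hlt
    have hspan : sw (n + 1) ++ q = r ++ sw (n + 1) ++ q' := by
      apply List.append_cancel_left (as := p)
      rw [← List.append_assoc, ← h, h']
      simp
    have hinf : r ++ sw (n + 1) <:+: w := ⟨p, q', by simp [h']⟩
    obtain ⟨m, hm, hmr⟩ := exists_later_sw_isInfix n (u := r ++ sw (n + 1)) (hw.mono hinf)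
      (List.prefix_of_prefix_length_le (List.prefix_append _ q)
        (hspan ▸ List.prefix_append _ q') (by simp))
      (List.suffix_append _ _) (by simpa using hr)
    have := hu.2.2 _ ⟨m, rfl⟩ (hmr.trans hinf)
    exact absurd (sw_length_lt (by omega) hm) (by omega)

theorem countP_range_eq_one {n k : ℕ} {f : ℕ → Bool} (hk : k < n)
    (h : ∀ i < n, f i = true ↔ i = k) : (List.range n).countP f = 1 := by
  rw [← List.count_eq_one_of_mem List.nodup_range (List.mem_range.2 hk), List.count]
  refine List.countP_congr fun i hi => ?_
  rw [h i (List.mem_range.1 hi)]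
  simp

/-- every factor `ω ∉ {ε, ab, ba, aba}` of `F_∞` has a unique
singular kernel, which occurs in `ω` exactly once, and `ω` admits a unique
decomposition `ω = μ₁ · sk(ω) · μ₂`. -/
theorem stmt0 (ω : List Bool) (hfac : IsFactor ω) (hne : ω ∉ excl) :
    (∃! u : List Bool, IsKernelOf u ω) ∧
    (∀ u : List Bool, IsKernelOf u ω →
      ((List.range ω.length).countP (fun i => decide (u <+: ω.drop i)) = 1) ∧
      (∃! μ : List Bool × List Bool, ω = μ.1 ++ u ++ μ.2)) := by
  have hF := hfac.isFibFactor
  have hl := hF.letter_or_sw_isInfix hne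
  obtain ⟨u₀, hu₀⟩ := exists_isKernelOf hl
  refine ⟨⟨u₀, hu₀, fun v hv => hv.unique hu₀ hl⟩, fun u hu => ?_⟩
  obtain ⟨p, q, hpq⟩ := hu.2.1
  have hlen : ∀ {p' q'}, ω = p' ++ u ++ q' → p'.length = p.length := fun h =>
    (hu.length_le_of_decomp hF hl hpq.symm h).antisymm
      (hu.length_le_of_decomp hF hl h hpq.symm)
  have hpos := List.length_pos_iff.2 hu.ne_nil
  constructor
  · refine countP_range_eq_one (k := p.length) ?_ fun i hi => ?_
    · have := congrArg List.length hpq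
      simp at this
      omega
    · rw [decide_eq_true_iff]
      constructor
      · rintro ⟨r, hr⟩
        have := hlen (p' := ω.take i) (q' := r) (by
          rw [List.append_assoc, hr, List.take_append_drop])
        rw [← this, List.length_take]
        omega
      · rintro rfl
        exact ⟨q, by simp [← hpq]⟩
  · refine ⟨(p, q), hpq.symm, ?_⟩
    rintro ⟨p', q'⟩ h
    have h2 : p' ++ (u ++ q') = p ++ (u ++ q) := by
      rw [← List.append_assoc, ← List.append_assoc, hpq]
      exact h.symm
    obtain ⟨rfl, h3⟩ := List.append_inj h2 (hlen h)
    rw [List.append_cancel_left h3]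
end

section
/- For every k ≥ 1, the singular word s_k satisfies s_k = β_k α_k^{-1} s_{k-1} s_{k-2} and s_k = s_{k-2} s_{k-1} α_k^{-1} β_k; concretely, s_k equals the word obtained from s_{k-1} by replacing its first letter (which is α_k) by β_k, followed by s_{k-2}, and s_k also equals s_{k-2} followed by the word obtained from s_{k-1} by replacing its last letter (which is α_k) by β_k. -/
/-- The last letter of the Fibonacci word `Fw n`. -/
def fibLast : ℕ → Bool
  | 0 => false
  | (n+1) => !fibLast n

/-- The central word obtained from `Fw (n+1)` by deleting its last two letters. -/
def centralWord : ℕ → List Bool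
  | 0 => []
  | 1 => [false]
  | (n+2) => Fw (n+2) ++ centralWord n

theorem Fw_succ_eq_centralWord_append (n : ℕ) :
    Fw (n+1) = centralWord n ++ [fibLast n, !fibLast n] := by
  induction n using Nat.twoStepInduction with
  | zero => rfl
  | one => rfl
  | more n ih _ =>
    rw [Fw, ih]
    simp [centralWord, fibLast]

theorem Fw_getLastD (n : ℕ) : (Fw n).getLastD false = fibLast n := by
  cases n with
  | zero => rfl
  | succ n =>
    rw [Fw_succ_eq_centralWord_append, List.getLastD_eq_getLast?]
    simp [fibLast]

theorem sw_eq_centralWord (n : ℕ) :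
    sw (n+2) = fibLast n :: (centralWord n ++ [fibLast n]) := by
  rw [sw, Fw_getLastD, Fw_succ_eq_centralWord_append]
  simp [fibLast]

theorem Fw_append_centralWord_comm (n : ℕ) :
    Fw (n+2) ++ centralWord n = Fw (n+1) ++ centralWord (n+1) := by
  induction n with
  | zero => rfl
  | succ n ih =>
    rw [show Fw (n+1+2) = Fw (n+2) ++ Fw (n+1) from rfl, List.append_assoc, ← ih]
    rfl

theorem centralWord_eq_append_left (n : ℕ) :
    centralWord (n+2) =
      centralWord (n+1) ++ [!fibLast n, fibLast n] ++ centralWord n := by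
  rw [centralWord, Fw_succ_eq_centralWord_append]
  simp [fibLast]

theorem centralWord_eq_append_right (n : ℕ) :
    centralWord (n+2) =
      centralWord n ++ [fibLast n, !fibLast n] ++ centralWord (n+1) := by
  rw [centralWord, Fw_append_centralWord_comm, Fw_succ_eq_centralWord_append]

/-- for `k ≥ 1`, `s_k = β_k α_k⁻¹ s_{k-1} s_{k-2}` and
`s_k = s_{k-2} s_{k-1} α_k⁻¹ β_k`: the first (resp. last) letter of `s_{k-1}` is `α_k`,
and `s_k` is obtained by replacing the first letter of `s_{k-1}` by `β_k` and appending
`s_{k-2}`, and also by `s_{k-2}` followed by `s_{k-1}` with its last letter replaced by `β_k`. -/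
theorem stmt3 (k : ℕ) (hk : 1 ≤ k) :
    (sw k).head? = some ((Fw k).getLastD false) ∧
    (sw k).getLast? = some ((Fw k).getLastD false) ∧
    sw (k+1) = ((!((Fw k).getLastD false)) :: (sw k).tail) ++ sw (k-1) ∧
    sw (k+1) = sw (k-1) ++ ((sw k).dropLast ++ [!((Fw k).getLastD false)]) := by
  match k, hk with
  | 1, _ => decide
  | 2, _ => decide
  | n+3, _ =>
    simp only [Fw_getLastD, show n + 3 - 1 = n + 2 from rfl,
      show n + 3 + 1 = n + 2 + 2 from rfl, show n + 3 = n + 1 + 2 from rfl,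
      sw_eq_centralWord, fibLast, Bool.not_not]
    refine ⟨rfl, by rw [← List.cons_append, List.getLast?_concat], ?_, ?_⟩
    · simp [centralWord_eq_append_left]
    · simp [centralWord_eq_append_right, List.dropLast_cons_of_ne_nil]
end

section
/- For every k ≥ 2, the singular word s_k satisfies the recurrence s_k = s_{k-2} s_{k-3} s_{k-2} (concatenation of words). -/
theorem Fw_eq_append_last (n : ℕ) : ∃ p : List Bool, Fw n = p ++ [n.bodd] := by
  induction n using Nat.twoStepInduction with
  | zero => exact ⟨[], rfl⟩
  | one => exact ⟨[false], rfl⟩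
  | more n ih _ =>
    obtain ⟨p, hp⟩ := ih
    exact ⟨Fw (n + 1) ++ p, by simp [Fw, hp]⟩

theorem sw_succ_of_Fw_eq {n : ℕ} {p : List Bool} {c : Bool} (h : Fw n = p ++ [c]) :
    sw (n + 1) = (!c) :: p := by
  simp [sw, h, List.getLastD_eq_getLast?]

/-- for every `k ≥ 2`, `s_k = s_{k-2} s_{k-3} s_{k-2}`. -/
theorem stmt4 (k : ℕ) (hk : 2 ≤ k) :
    sw (k+1) = sw (k-1) ++ sw (k-2) ++ sw (k-1) := by
  obtain ⟨m, rfl⟩ := Nat.exists_eq_add_of_le' hk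
  cases m with
  | zero => rfl
  | succ n =>
    obtain ⟨p, hp⟩ := Fw_eq_append_last n
    obtain ⟨q, hq⟩ := Fw_eq_append_last (n + 1)
    have hF : Fw (n + 3) = (q ++ [(n + 1).bodd] ++ p ++ [n.bodd] ++ q) ++ [(n + 1).bodd] := by
      simp [Fw, hp, hq]
    change sw (n + 3 + 1) = sw (n + 1 + 1) ++ sw (n + 1) ++ sw (n + 1 + 1)
    rw [sw_succ_of_Fw_eq hF, sw_succ_of_Fw_eq hq, sw_succ_of_Fw_eq hp]
    simp
end

section
/- For k ≥ 1 let θ_k be the word obtained by concatenating: s_{k+1} with its first letter (which is α_k) deleted, then s_k, then s_{k+1} with its last letter (which is α_k) deleted (that is, θ_k = α_k^{-1} s_{k+1} s_k s_{k+1} α_k^{-1}). Then: (1) the singular kernel of θ_k is the middle factor s_k; (2) every factor τ of θ_k with sk(τ) = s_k occurs in θ_k exactly once; (3) every factor ω of F_∞ with sk(ω) = s_k is a factor of θ_k. -/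
/-- The next-to-last letter of `Fw (n + 1)`. -/
def penult : ℕ → Bool
  | 0 => false
  | n + 1 => !penult n

/-- The central word obtained from `Fw (n + 1)` by deleting its last two letters. -/
def central : ℕ → List Bool
  | 0 => []
  | 1 => [false]
  | n + 2 => central (n + 1) ++ [!penult n, penult n] ++ central n

theorem Fw_succ_eq_central : ∀ n, Fw (n + 1) = central n ++ [penult n, !penult n]
  | 0 => rfl
  | 1 => rfl
  | n + 2 => by
    rw [Fw, Fw_succ_eq_central (n + 1), Fw_succ_eq_central n]
    simp [central, penult]

theorem sw_add_two (n : ℕ) : sw (n + 2) = penult n :: (central n ++ [penult n]) := by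
  have h : central n ++ [penult n, !penult n] = (central n ++ [penult n]) ++ [!penult n] := by simp
  rw [sw, Fw_succ_eq_central, h, List.dropLast_concat]
  simp

theorem central_add_two_eq (n : ℕ) :
    central (n + 2) = central n ++ [penult n, !penult n] ++ central (n + 1) := by
  induction n with
  | zero => rfl
  | succ n ih =>
    have h : central (n + 1) ++ [!penult n, penult n] ++ central n
        = central n ++ [penult n, !penult n] ++ central (n + 1) := ih ▸ rfl
    rw [central, ih, ← h]
    simp only [penult, List.append_assoc, Bool.not_not] at h ⊢
    rw [h]

theorem reverse_central : ∀ n, (central n).reverse = central n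
  | 0 => rfl
  | 1 => rfl
  | n + 2 => by
    conv_rhs => rw [central_add_two_eq]
    simp [central, reverse_central n, reverse_central (n + 1)]

theorem reverse_sw_add_two (n : ℕ) : (sw (n + 2)).reverse = sw (n + 2) := by
  simp [sw_add_two, reverse_central]

theorem central_prefix_succ : ∀ n, central n <+: central (n + 1)
  | 0 => List.nil_prefix
  | n + 1 => by
    rw [central, List.append_assoc]
    exact List.prefix_append _ _

theorem central_prefix_of_le {m n : ℕ} (h : m ≤ n) : central m <+: central n := by
  induction n, h using Nat.le_induction with
  | base => exact List.prefix_rfl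
  | succ n _ ih => exact ih.trans (central_prefix_succ n)

theorem length_central_add_two (n : ℕ) :
    (central (n + 2)).length = (central (n + 1)).length + (central n).length + 2 := by
  simp [central]; omega

theorem length_central_lt_succ : ∀ n, (central n).length < (central (n + 1)).length
  | 0 => by simp [central]
  | n + 1 => by rw [length_central_add_two]; omega

theorem length_central_strictMono : StrictMono fun n => (central n).length :=
  strictMono_nat_of_lt_succ length_central_lt_succ

theorem length_sw_add_two (n : ℕ) : (sw (n + 2)).length = (central n).length + 2 := by
  simp [sw_add_two]

/-- In a word `w` with period `u.length` starting like `u ++ u ++ ⋯`, every factor of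
length `u.length` is a permutation of `u`. -/
theorem List.IsInfix.perm_of_prefix_append {α : Type*} {u v w : List α} (hw : w <+: u ++ w)
    (hv : v <:+: w) (hlen : v.length = u.length) : v.Perm u := by
  induction w generalizing u with
  | nil =>
    obtain rfl := List.infix_nil.mp hv
    rw [List.length_eq_zero_iff.mp hlen.symm]
  | cons c w ih =>
    rcases List.infix_cons_iff.mp hv with hv | hv
    · rw [(List.prefix_of_prefix_length_le (hv.trans hw) (List.prefix_append u _)
        hlen.le).eq_of_length hlen]
    · cases u with
      | nil => rw [List.length_eq_zero_iff.mp hlen]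
      | cons d u =>
        rw [List.cons_append, List.cons_prefix_cons] at hw
        obtain ⟨rfl, hw⟩ := hw
        have := ih (u := u ++ [c]) (by simpa using hw) hv (by simpa using hlen)
        exact this.trans (List.perm_append_singleton c u)

theorem not_sw_infix_central (n : ℕ) : ¬ sw (n + 2) <:+: central (n + 2) := by
  intro h
  have hper : central (n + 2) <+: (central n ++ [penult n, !penult n]) ++ central (n + 2) := by
    nth_rw 1 [central_add_two_eq]
    exact (List.prefix_append_right_inj _).mpr (central_prefix_succ (n + 1))
  have hperm := h.perm_of_prefix_append hper (by simp [length_sw_add_two])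
  have := hperm.count_eq (penult n)
  rw [sw_add_two] at this
  simp at this

theorem infix_left_of_append_eq {α : Type*} {x y z q d : List α} (h : x ++ y ++ z = q ++ d)
    (hle : d.length ≤ z.length) : y <:+: q := by
  rcases List.append_eq_append_iff.mp h with ⟨t, rfl, -⟩ | ⟨t, h1, rfl⟩
  · exact ⟨x, t, rfl⟩
  · obtain rfl : t = [] := by simpa using hle
    exact ⟨x, [], by simpa using h1⟩

theorem infix_right_of_append_eq {α : Type*} {x y z q d : List α} (h : x ++ y ++ z = d ++ q)
    (hle : d.length ≤ x.length) : y <:+: q := by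
  have h' : z.reverse ++ y.reverse ++ x.reverse = q.reverse ++ d.reverse := by
    simpa using congrArg List.reverse h
  exact List.reverse_infix.mp (infix_left_of_append_eq h' (by simpa using hle))

theorem infix_of_append_eq {α : Type*} {x y z c s d : List α} (h : x ++ y ++ z = c ++ s ++ d)
    (hc : x.length ≤ c.length) (hd : z.length ≤ d.length) : s <:+: y := by
  obtain ⟨t, rfl⟩ : x <+: c := List.prefix_of_prefix_length_le
    (⟨y ++ z, by simp⟩ : x <+: x ++ y ++ z) ⟨s ++ d, by simp [h]⟩ hc
  obtain ⟨r, rfl⟩ : z <:+ d := List.suffix_of_suffix_length_le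
    (⟨x ++ y, rfl⟩ : z <:+ x ++ y ++ z) ⟨x ++ t ++ s, by simp [h]⟩ hd
  refine ⟨t, r, List.append_cancel_left (as := x) (List.append_cancel_right (bs := z) ?_)⟩
  simpa using h.symm

theorem central_add_three_eq (n : ℕ) :
    central (n + 3) = (central (n + 1) ++ [!penult n]) ++ sw (n + 2) ++
      ([!penult n] ++ central (n + 1)) := by
  rw [central, central, sw_add_two]
  simp [penult]

/-- A factor of a central word that avoids the singular word in the middle lies in the
preceding central word. -/
theorem infix_central_of_not_sw_infix {n : ℕ} {w : List Bool} (hw : w <:+: central (n + 3))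
    (hs : ¬ sw (n + 2) <:+: w) : w <:+: central (n + 2) := by
  obtain ⟨x, z, h⟩ := hw
  by_cases hz : (central (n + 1)).length + 2 ≤ z.length
  · refine infix_left_of_append_eq (x := x) (z := z)
      (d := [!penult (n + 1), penult (n + 1)] ++ central (n + 1)) ?_
      (by simp; omega)
    rw [h, central, List.append_assoc]
  by_cases hx : (central (n + 1)).length + 2 ≤ x.length
  · refine infix_right_of_append_eq (x := x) (z := z)
      (d := central (n + 1) ++ [penult (n + 1), !penult (n + 1)]) ?_
      (by simpa using hx)
    rw [h, central_add_two_eq]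
  · rw [central_add_three_eq] at h
    exact absurd (infix_of_append_eq h (by simp; omega) (by simp; omega)) hs

theorem theta_eq_central (n : ℕ) :
    (sw (n + 3)).tail ++ sw (n + 2) ++ (sw (n + 3)).dropLast = central (n + 3) := by
  rw [central_add_three_eq, sw_add_two (n + 1), ← List.cons_append, List.dropLast_concat]
  simp [penult]

theorem length_le_of_sw_infix_central {m n : ℕ} (h : sw n <:+: central (m + 3)) :
    (sw n).length ≤ (sw (m + 2)).length := by
  match n with
  | 0 => simp [sw]
  | 1 => simp [sw, Fw]
  | j + 2 =>
    rw [length_sw_add_two, length_sw_add_two]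
    have hj : j ≤ m := by
      by_contra! hlt
      exact not_sw_infix_central j (h.trans (central_prefix_of_le (by omega)).isInfix)
    have := length_central_strictMono.monotone hj
    simpa using this

theorem isKernelOf_central (m : ℕ) : IsKernelOf (sw (m + 2)) (central (m + 3)) := by
  refine ⟨⟨_, rfl⟩, ⟨_, _, (central_add_three_eq m).symm⟩, ?_⟩
  rintro _ ⟨n, rfl⟩ h
  exact length_le_of_sw_infix_central h

theorem length_of_sw_occurrence {m : ℕ} {x z : List Bool}
    (h : x ++ sw (m + 2) ++ z = central (m + 3)) : x.length = (central (m + 1)).length + 1 := by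
  have key : ∀ x z : List Bool, x ++ sw (m + 2) ++ z = central (m + 3) →
      z.length < (central (m + 1)).length + 2 := by
    intro x z h
    by_contra! hz
    refine not_sw_infix_central m (infix_left_of_append_eq (x := x) (z := z)
      (d := [!penult (m + 1), penult (m + 1)] ++ central (m + 1)) ?_ (by simp; omega))
    rw [h, central, List.append_assoc]
  have h1 := key x z h
  have h2 := key z.reverse x.reverse (by
    rw [← reverse_central, ← h]
    simp [reverse_sw_add_two])
  have h3 := congrArg List.length h
  simp only [List.length_append, length_sw_add_two, length_central_add_two,
    List.length_reverse] at h2 h3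
  omega

theorem Fw_prefix_central (n : ℕ) : Fw (n + 1) <+: central (n + 2) := by
  rw [central_add_two_eq, Fw_succ_eq_central]
  exact List.prefix_append _ _

theorem le_length_central (n : ℕ) : n ≤ (central n).length :=
  length_central_strictMono.le_apply

theorem getElem?_central {n N : ℕ} (h : n + 2 ≤ N) : (central N)[n]? = some (fw n) := by
  have hlt : n < (Fw (n + 1)).length := by
    have := le_length_central n
    rw [Fw_succ_eq_central]; simp; omega
  have hp := (Fw_prefix_central n).trans (central_prefix_of_le h)
  obtain ⟨t, ht⟩ := hp
  rw [← ht, List.getElem?_append_left hlt, fw, List.getD_eq_getElem _ _ hlt,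
    List.getElem?_eq_getElem hlt]

theorem seg_infix_central {i n N : ℕ} (h : i + n + 2 ≤ N) : seg i n <:+: central N := by
  have : seg i n = ((central N).drop i).take n := by
    apply List.ext_getElem?
    intro t
    by_cases ht : t < n
    · rw [List.getElem?_take_of_lt ht, List.getElem?_drop, getElem?_central (by omega)]
      simp [seg, ht]
    · rw [List.getElem?_eq_none (by simp [seg]; omega), List.getElem?_eq_none (by simp; omega)]
  rw [this]
  exact (List.take_prefix _ _).isInfix.trans (List.drop_suffix _ _).isInfix

theorem IsFactor.infix_central_of_isKernelOf {m : ℕ} {w : List Bool} (hw : IsFactor w)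
    (hk : IsKernelOf (sw (m + 2)) w) : w <:+: central (m + 3) := by
  obtain ⟨i, hi⟩ := hw
  have hbig : w <:+: central (m + 3 + (i + w.length)) := by
    have := seg_infix_central (i := i) (n := w.length) (N := m + 3 + (i + w.length)) (by omega)
    rwa [hi] at this
  generalize i + w.length = d at hbig
  induction d with
  | zero => exact hbig
  | succ d ih =>
    rw [show m + 3 + (d + 1) = m + 1 + d + 3 by omega] at hbig
    refine ih ?_
    rw [show m + 3 + d = m + 1 + d + 2 by omega]
    refine infix_central_of_not_sw_infix hbig fun hs => ?_
    have h1 := hk.2.2 _ ⟨_, rfl⟩ hs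
    have h2 := length_central_strictMono (show m < m + 1 + d by omega)
    simp only [length_sw_add_two] at h1 h2
    omega

theorem countP_occurrences_central {m : ℕ} {w : List Bool} (hw : w <:+: central (m + 3))
    (hs : sw (m + 2) <:+: w) :
    (List.range ((central (m + 3)).length + 1)).countP
      (fun i => decide (w <+: (central (m + 3)).drop i)) = 1 := by
  obtain ⟨x, z, h⟩ := hw
  obtain ⟨p, q, rfl⟩ := hs
  have hx : x.length ∈ List.range ((central (m + 3)).length + 1) := by
    rw [← h]; simp
  refine Eq.trans (List.countP_congr fun i hi => ?_) (List.count_eq_one_of_mem List.nodup_range hx)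
  simp only [List.mem_range] at hi
  simp only [decide_eq_true_eq, beq_iff_eq]
  constructor
  · rintro ⟨r, hr⟩
    have h1 := length_of_sw_occurrence (m := m) (x := (central (m + 3)).take i ++ p)
      (z := q ++ r) (by
        conv_rhs => rw [← List.take_append_drop i (central (m + 3)), ← hr]
        simp)
    have h2 := length_of_sw_occurrence (m := m) (x := x ++ p) (z := q ++ z) (by rw [← h]; simp)
    simp only [List.length_append, List.length_take] at h1 h2
    omega
  · rintro rfl
    exact ⟨z, by rw [← h]; simp⟩

/-- for `k ≥ 1`, let `θ_k = α_k⁻¹ s_{k+1} s_k s_{k+1} α_k⁻¹` (the first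
and last letters of `s_{k+1}` are `α_k`). Then (1) the singular kernel of `θ_k` is the
middle `s_k`; (2) every factor `τ` of `θ_k` with `sk(τ) = s_k` occurs in `θ_k` exactly
once; (3) every factor `ω` of `F_∞` with `sk(ω) = s_k` is a factor of `θ_k`. -/
theorem stmt7 (k : ℕ) (hk : 1 ≤ k) :
    (sw (k+2)).head? = some ((Fw k).getLastD false) ∧
    (sw (k+2)).getLast? = some ((Fw k).getLastD false) ∧
    IsKernelOf (sw (k+1)) ((sw (k+2)).tail ++ sw (k+1) ++ (sw (k+2)).dropLast) ∧
    (∀ τ : List Bool,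
      τ <:+: ((sw (k+2)).tail ++ sw (k+1) ++ (sw (k+2)).dropLast) →
      IsKernelOf (sw (k+1)) τ →
      (List.range (((sw (k+2)).tail ++ sw (k+1) ++ (sw (k+2)).dropLast).length + 1)).countP
        (fun i => decide
          (τ <+: (((sw (k+2)).tail ++ sw (k+1) ++ (sw (k+2)).dropLast).drop i))) = 1) ∧
    (∀ ω : List Bool, IsFactor ω → IsKernelOf (sw (k+1)) ω →
      ω <:+: ((sw (k+2)).tail ++ sw (k+1) ++ (sw (k+2)).dropLast)) := by
  obtain ⟨m, rfl⟩ : ∃ m, k = m + 1 := ⟨k - 1, by omega⟩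
  rw [theta_eq_central]
  refine ⟨?_, ?_, isKernelOf_central m, fun τ hτ hk => countP_occurrences_central hτ hk.2.1,
    fun ω hω hk => hω.infix_central_of_isKernelOf hk⟩
  · rw [sw_add_two, Fw_succ_eq_central]
    simp [penult]
  · rw [sw_add_two, Fw_succ_eq_central, ← List.cons_append, List.getLast?_concat]
    simp [penult]
end
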